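/- Let Ω⁺ = B_R(0) ⊂ ℝ³ be the open ball of radius R > 0 centered at the origin. Then the minimizer of the unconstrained problem min{ E(Ω⁻) : Ω⁻ measurable, |Ω⁺ ∩ Ω⁻| = 0, |Ω⁻| < ∞ } is, up to a set of Lebesgue measure zero, the annulus C = B_{2^{1/3} R}(0) \ closure(B_R(0)). -/

import Mathlib

open MeasureTheory Real

noncomputable section

abbrev E3 := EuclideanSpace ℝ (Fin 3)

/-- The Coulomb kernel in ℝ³. -/
def coul (x y : E3) : ℝ := 1 / (4 * π * ‖x - y‖)

/-- The Coulomb energy `E(Ω⁻)`. -/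
def energy (Ωp Ωm : Set E3) : ℝ :=
  (∫ x in Ωp, ∫ y in Ωp, coul x y) + (∫ x in Ωm, ∫ y in Ωm, coul x y)
    - 2 * ∫ x in Ωp, ∫ y in Ωm, coul x y

/-- Admissible configurations for the unconstrained problem. -/
def Adm (Ωp Ωm : Set E3) : Prop :=
  MeasurableSet Ωm ∧ volume (Ωp ∩ Ωm) = 0 ∧ volume Ωm < ⊤

open Set
open scoped ENNReal

/-- The Coulomb potential of a set, with values in `ℝ≥0∞`. -/
def coulombPotential (B : Set E3) (x : E3) : ℝ≥0∞ := ∫⁻ y in B, ENNReal.ofReal (coul x y)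

/-- The mutual Coulomb energy of two sets, with values in `ℝ≥0∞`. -/
def mutualEnergy (A B : Set E3) : ℝ≥0∞ := ∫⁻ x in A, coulombPotential B x

theorem coul_nonneg (x y : E3) : 0 ≤ coul x y := by
  unfold coul; positivity

theorem coul_comm (x y : E3) : coul x y = coul y x := by
  unfold coul; rw [norm_sub_rev]

@[fun_prop]
theorem measurable_coul : Measurable (fun p : E3 × E3 => coul p.1 p.2) := by
  unfold coul; fun_prop

@[fun_prop]
theorem measurable_ofReal_coul :
    Measurable (fun p : E3 × E3 => ENNReal.ofReal (coul p.1 p.2)) :=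
  measurable_coul.ennreal_ofReal

theorem measurable_coulombPotential (B : Set E3) : Measurable (coulombPotential B) :=
  measurable_ofReal_coul.lintegral_prod_right'

theorem mutualEnergy_comm (A B : Set E3) : mutualEnergy A B = mutualEnergy B A := by
  unfold mutualEnergy coulombPotential
  rw [lintegral_lintegral_swap (by exact measurable_ofReal_coul.aemeasurable)]
  simp_rw [coul_comm]

theorem integral_gaussian_mul_gaussian (x y : E3) {s : ℝ} (hs : 0 < s) :
    ∫⁻ z : E3, ENNReal.ofReal (exp (-2 * s ^ 2 * ‖x - z‖ ^ 2)) *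
        ENNReal.ofReal (exp (-2 * s ^ 2 * ‖y - z‖ ^ 2)) =
      ENNReal.ofReal (exp (-s ^ 2 * ‖x - y‖ ^ 2) * (√π / (2 * s)) ^ 3) := by
  have hb : 0 < 4 * s ^ 2 := by positivity
  set m : E3 := (1 / 2 : ℝ) • (x + y) with hm
  have key : ∀ z : E3, ENNReal.ofReal (exp (-2 * s ^ 2 * ‖x - z‖ ^ 2)) *
        ENNReal.ofReal (exp (-2 * s ^ 2 * ‖y - z‖ ^ 2)) =
      ENNReal.ofReal (exp (-s ^ 2 * ‖x - y‖ ^ 2)) *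
        ENNReal.ofReal (exp (-(4 * s ^ 2) * ‖z - m‖ ^ 2)) := by
    intro z
    rw [← ENNReal.ofReal_mul (exp_pos _).le, ← ENNReal.ofReal_mul (exp_pos _).le, ← exp_add,
      ← exp_add]
    congr 2
    have h1 : x - y = (x - z) - (y - z) := by abel
    have h2 : z - m = -((1 / 2 : ℝ) • ((x - z) + (y - z))) := by
      rw [hm]; module
    rw [h1, h2, norm_neg, norm_smul, mul_pow]
    generalize x - z = a, y - z = b
    rw [norm_sub_sq_real, norm_add_sq_real]
    norm_num
    ring
  simp_rw [key]
  rw [lintegral_const_mul _ (by fun_prop),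
    lintegral_sub_right_eq_self (fun z : E3 => ENNReal.ofReal (exp (-(4 * s ^ 2) * ‖z‖ ^ 2))) m,
    ENNReal.ofReal_mul (exp_pos _).le]
  congr 1
  have hint := GaussianFourier.integral_rexp_neg_mul_sq_norm (V := E3) hb
  have hval : (π / (4 * s ^ 2)) ^ ((Module.finrank ℝ E3 : ℝ) / 2) = (√π / (2 * s)) ^ 3 := by
    have h : π / (4 * s ^ 2) = (√π / (2 * s)) ^ (2 : ℝ) := by
      rw [rpow_two, div_pow, sq_sqrt pi_pos.le]; ring
    rw [h, ← rpow_mul (by positivity), ← rpow_natCast]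
    congr 1
    norm_num
  rw [hval] at hint
  rw [← hint, ofReal_integral_eq_lintegral_ofReal]
  · refine Integrable.of_integral_ne_zero ?_
    rw [hint]; positivity
  · exact Filter.Eventually.of_forall fun _ => (exp_pos _).le

theorem lintegral_gaussian_Ioi {r : ℝ} (hr : 0 < r) :
    ∫⁻ s in Ioi (0 : ℝ), ENNReal.ofReal (exp (-s ^ 2 * r ^ 2)) =
      ENNReal.ofReal (√π / (2 * r)) := by
  have h := integral_gaussian_Ioi (r ^ 2)
  have hr2 : √(π / r ^ 2) / 2 = √π / (2 * r) := by
    rw [sqrt_div pi_pos.le, sqrt_sq hr.le]; ring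
  rw [hr2] at h
  rw [← h, ofReal_integral_eq_lintegral_ofReal]
  · refine lintegral_congr fun s => ?_
    ring_nf
  · refine Integrable.of_integral_ne_zero ?_
    rw [h]; positivity
  · exact Filter.Eventually.of_forall fun _ => (exp_pos _).le

/-- The Coulomb kernel is a superposition of products of Gaussians. -/
theorem ofReal_coul_eq_lintegral_gaussian {x y : E3} (hxy : x ≠ y) :
    ENNReal.ofReal (coul x y) = ∫⁻ w : ℝ × E3,
      ENNReal.ofReal (4 / π ^ 3 * w.1 ^ 3) *
        (ENNReal.ofReal (exp (-2 * w.1 ^ 2 * ‖x - w.2‖ ^ 2)) *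
          ENNReal.ofReal (exp (-2 * w.1 ^ 2 * ‖y - w.2‖ ^ 2)))
      ∂((volume.restrict (Ioi 0)).prod volume) := by
  have hr : 0 < ‖x - y‖ := norm_pos_iff.2 (sub_ne_zero.2 hxy)
  rw [lintegral_prod _ (by fun_prop)]
  have : ∀ s ∈ Ioi (0 : ℝ), ∫⁻ z : E3, ENNReal.ofReal (4 / π ^ 3 * s ^ 3) *
        (ENNReal.ofReal (exp (-2 * s ^ 2 * ‖x - z‖ ^ 2)) *
          ENNReal.ofReal (exp (-2 * s ^ 2 * ‖y - z‖ ^ 2))) =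
      ENNReal.ofReal (√π / (2 * π ^ 2)) * ENNReal.ofReal (exp (-s ^ 2 * ‖x - y‖ ^ 2)) := by
    intro s hs
    have hs : 0 < s := hs
    rw [lintegral_const_mul _ (by fun_prop), integral_gaussian_mul_gaussian x y hs,
      ← ENNReal.ofReal_mul (by positivity), ← ENNReal.ofReal_mul (by positivity)]
    congr 1
    have h3 : √π ^ 3 = √π * π := by rw [pow_succ, sq_sqrt pi_pos.le]; ring
    rw [div_pow, h3]
    field_simp
    norm_num
  rw [setLIntegral_congr_fun measurableSet_Ioi this, lintegral_const_mul _ (by fun_prop),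
    lintegral_gaussian_Ioi hr, ← ENNReal.ofReal_mul (by positivity)]
  congr 1
  unfold coul
  have h2 : √π * √π = π := mul_self_sqrt pi_pos.le
  field_simp
  nlinarith [h2]

/-- The integral over `A` of the Gaussian with inverse width `w.1` centred at `w.2`. -/
def gaussianMass (A : Set E3) (w : ℝ × E3) : ℝ≥0∞ :=
  ∫⁻ x in A, ENNReal.ofReal (exp (-2 * w.1 ^ 2 * ‖x - w.2‖ ^ 2))

@[fun_prop]
theorem measurable_gaussianMass (A : Set E3) : Measurable (gaussianMass A) :=
  Measurable.lintegral_prod_right'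
    (f := fun p : (ℝ × E3) × E3 => ENNReal.ofReal (exp (-2 * p.1.1 ^ 2 * ‖p.2 - p.1.2‖ ^ 2)))
    (by fun_prop)

theorem mutualEnergy_eq_lintegral_gaussian (A B : Set E3) :
    mutualEnergy A B = ∫⁻ w : ℝ × E3, ENNReal.ofReal (4 / π ^ 3 * w.1 ^ 3) *
        (gaussianMass A w * gaussianMass B w)
      ∂((volume.restrict (Ioi 0)).prod volume) := by
  unfold mutualEnergy coulombPotential
  have hae : ∀ x : E3, ∀ᵐ y ∂(volume.restrict B), x ≠ y := fun x => by
    refine ae_restrict_of_ae ?_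
    have : (volume : Measure E3) {x} = 0 := measure_singleton x
    filter_upwards [compl_mem_ae_iff.2 this] with y hy h
    exact hy h.symm
  have h1 : ∀ x : E3, ∫⁻ y in B, ENNReal.ofReal (coul x y) = ∫⁻ w : ℝ × E3,
      (ENNReal.ofReal (4 / π ^ 3 * w.1 ^ 3) *
        gaussianMass B w) *
        ENNReal.ofReal (exp (-2 * w.1 ^ 2 * ‖x - w.2‖ ^ 2))
      ∂((volume.restrict (Ioi 0)).prod volume) := by
    intro x
    rw [lintegral_congr_ae ((hae x).mono fun y hy => ofReal_coul_eq_lintegral_gaussian hy),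
      lintegral_lintegral_swap (by fun_prop)]
    refine lintegral_congr fun w => ?_
    rw [lintegral_const_mul _ (by fun_prop), lintegral_const_mul _ (by fun_prop), gaussianMass]
    ring
  simp_rw [h1]
  rw [lintegral_lintegral_swap]
  · refine lintegral_congr fun w => ?_
    rw [lintegral_const_mul _ (by fun_prop), ← gaussianMass]
    ring
  · refine Measurable.aemeasurable ?_
    fun_prop

/-- The Coulomb interaction is positive semidefinite. -/
theorem two_mul_mutualEnergy_le (A B : Set E3) :
    2 * mutualEnergy A B ≤ mutualEnergy A A + mutualEnergy B B := by
  simp_rw [mutualEnergy_eq_lintegral_gaussian]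
  rw [← lintegral_const_mul _ (by fun_prop),
    ← lintegral_add_left (by fun_prop)]
  refine lintegral_mono fun w => ?_
  have h : ∀ a b : ℝ≥0∞, 2 * (a * b) ≤ a * a + b * b := by
    intro a b
    rcases eq_or_ne a ∞ with rfl | ha
    · simp
    rcases eq_or_ne b ∞ with rfl | hb
    · simp
    lift a to NNReal using ha
    lift b to NNReal using hb
    norm_cast
    have := two_mul_le_add_sq (a : ℝ) b
    rw [← NNReal.coe_le_coe]
    push_cast
    linarith
  rw [mul_left_comm, ← mul_add]
  gcongr
  exact h _ _

theorem coulombPotential_image_linearIsometryEquiv (e : E3 ≃ₗᵢ[ℝ] E3) (B : Set E3) (x : E3) :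
    coulombPotential (e '' B) (e x) = coulombPotential B x := by
  unfold coulombPotential
  have he : e '' B = e.symm ⁻¹' B := by
    exact e.toEquiv.image_eq_preimage_symm B
  rw [← (e.measurePreserving).setLIntegral_comp_emb e.toHomeomorph.measurableEmbedding]
  simp only [coul, ← map_sub, e.norm_map]

theorem lintegral_inv_dist_disc {d q : ℝ} (hd : d ≠ 0) (hq : 0 ≤ q) :
    ∫⁻ t in Ioo 0 (√q), ENNReal.ofReal (t / √(d ^ 2 + t ^ 2)) =
      ENNReal.ofReal (√(d ^ 2 + q) - |d|) := by
  have hpos : ∀ t : ℝ, 0 < d ^ 2 + t ^ 2 := fun t => by positivity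
  have hderiv : ∀ t : ℝ, HasDerivAt (fun t => √(d ^ 2 + t ^ 2)) (t / √(d ^ 2 + t ^ 2)) t := by
    intro t
    convert! ((hasDerivAt_pow 2 t).const_add (d ^ 2)).sqrt (hpos t).ne' using 1
    field_simp
    push_cast
    ring
  have hcont : Continuous fun t : ℝ => t / √(d ^ 2 + t ^ 2) :=
    continuous_id.div (by fun_prop) fun t => (sqrt_pos.2 (hpos t)).ne'
  have h := intervalIntegral.integral_eq_sub_of_hasDerivAt (a := 0) (b := √q)
    (fun t _ => hderiv t) (hcont.intervalIntegrable _ _)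
  rw [intervalIntegral.integral_of_le (sqrt_nonneg _), integral_Ioc_eq_integral_Ioo,
    sq_sqrt hq, zero_pow two_ne_zero, add_zero, sqrt_sq_eq_abs] at h
  rw [← h, ofReal_integral_eq_lintegral_ofReal]
  · exact (hcont.integrableOn_Icc (a := 0) (b := √q)).mono_set Ioo_subset_Icc_self
  · refine (ae_restrict_iff' measurableSet_Ioo).2 (Filter.Eventually.of_forall fun t ht => ?_)
    exact div_nonneg ht.1.le (sqrt_nonneg _)

theorem lintegral_E3_eq {f : E3 → ℝ≥0∞} (hf : Measurable f) :
    ∫⁻ y, f y = ∫⁻ a : ℝ, ∫⁻ p : ℝ × ℝ, f !₂[a, p.1, p.2] := by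
  have hpair : ∀ u : ℝ × ℝ → ℝ≥0∞, ∫⁻ v : Fin 2 → ℝ, u (v 0, v 1) = ∫⁻ p, u p := fun u =>
    (volume_preserving_finTwoArrow ℝ).lintegral_comp_emb
      MeasurableEquiv.finTwoArrow.measurableEmbedding u
  have hsplit := ((volume_preserving_piFinSuccAbove (fun _ : Fin 3 => ℝ) 0).symm).lintegral_comp_emb
    (MeasurableEquiv.measurableEmbedding _) (fun v => f (WithLp.toLp 2 v))
  rw [← (PiLp.volume_preserving_toLp (Fin 3)).lintegral_comp_emb
    (MeasurableEquiv.toLp 2 (Fin 3 → ℝ)).measurableEmbedding, ← hsplit, Measure.volume_eq_prod,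
    lintegral_prod _ (by fun_prop)]
  refine lintegral_congr fun a => ?_
  rw [← hpair]
  refine lintegral_congr fun v => ?_
  congr 2
  ext i
  fin_cases i <;> rfl

theorem lintegral_plane_radial {g : ℝ → ℝ≥0∞} (hg : Measurable g) :
    ∫⁻ p : ℝ × ℝ, g (p.1 ^ 2 + p.2 ^ 2) =
      ENNReal.ofReal (2 * π) * ∫⁻ t in Ioi (0 : ℝ), ENNReal.ofReal t * g (t ^ 2) := by
  rw [← lintegral_comp_polarCoord_symm]
  have h : ∀ p : ℝ × ℝ, ENNReal.ofReal p.1 •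
      g ((polarCoord.symm p).1 ^ 2 + (polarCoord.symm p).2 ^ 2) =
      ENNReal.ofReal p.1 * g (p.1 ^ 2) := by
    intro p
    have : (polarCoord.symm p).1 ^ 2 + (polarCoord.symm p).2 ^ 2 = p.1 ^ 2 := by
      simp only [polarCoord_symm_apply]
      linear_combination p.1 ^ 2 * (sin_sq_add_cos_sq p.2)
    rw [this, smul_eq_mul]
  simp_rw [h]
  rw [polarCoord_target, Measure.volume_eq_prod, ← Measure.prod_restrict,
    lintegral_prod _ (by fun_prop)]
  simp only [lintegral_const, Measure.restrict_apply_univ, Real.volume_Ioo]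
  rw [lintegral_mul_const _ (by fun_prop), mul_comm]
  ring_nf

theorem integral_sqrt_axial {ρ r : ℝ} (hρ : 0 < ρ) (hr : 0 < r) :
    ∫ a in (-ρ)..ρ, √(ρ ^ 2 + r ^ 2 - 2 * a * r) =
      ((ρ + r) ^ 3 - |ρ - r| ^ 3) / (3 * r) := by
  have hderiv : ∀ a ∈ Ioo (-ρ) ρ, HasDerivAt
      (fun a => -(1 / (3 * r)) * ((ρ ^ 2 + r ^ 2 - 2 * a * r) * √(ρ ^ 2 + r ^ 2 - 2 * a * r)))
      (√(ρ ^ 2 + r ^ 2 - 2 * a * r)) a := by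
    intro a ha
    have hpos : 0 < ρ ^ 2 + r ^ 2 - 2 * a * r := by
      nlinarith [sq_nonneg (ρ - r), mul_pos hr (sub_pos.2 ha.2)]
    have h1 : HasDerivAt (fun a => ρ ^ 2 + r ^ 2 - 2 * a * r) (-(2 * r)) a := by
      have := (((hasDerivAt_id a).const_mul 2).mul_const r).const_sub (ρ ^ 2 + r ^ 2)
      simpa using this
    convert! ((h1.mul (h1.sqrt hpos.ne')).const_mul (-(1 / (3 * r)))) using 1
    have hs := mul_self_sqrt hpos.le
    have hs0 : √(ρ ^ 2 + r ^ 2 - 2 * a * r) ≠ 0 := (sqrt_pos.2 hpos).ne'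
    set S := √(ρ ^ 2 + r ^ 2 - 2 * a * r)
    rw [← hs]
    field_simp
    ring
  rw [intervalIntegral.integral_eq_sub_of_hasDerivAt_of_le (by linarith) (by fun_prop) hderiv
    (Continuous.intervalIntegrable (by fun_prop) _ _)]
  have h1 : ρ ^ 2 + r ^ 2 - 2 * ρ * r = |ρ - r| ^ 2 := by rw [sq_abs]; ring
  have h2 : ρ ^ 2 + r ^ 2 - 2 * (-ρ) * r = (ρ + r) ^ 2 := by ring
  rw [h1, h2, sqrt_sq (abs_nonneg _), sqrt_sq (by positivity)]
  field_simp
  ring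

theorem integral_const_sub_id (r x y : ℝ) :
    ∫ a in x..y, (r - a) = r * (y - x) - (y ^ 2 - x ^ 2) / 2 := by
  rw [intervalIntegral.integral_sub intervalIntegrable_const intervalIntegral.intervalIntegrable_id,
    intervalIntegral.integral_const, integral_id, smul_eq_mul, mul_comm]

theorem integral_abs_sub_of_le {ρ r : ℝ} (hρ : 0 < ρ) (h : ρ ≤ r) :
    ∫ a in (-ρ)..ρ, |a - r| = 2 * ρ * r := by
  have : ∫ a in (-ρ)..ρ, |a - r| = ∫ a in (-ρ)..ρ, (r - a) := by
    refine intervalIntegral.integral_congr fun a ha => ?_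
    rw [uIcc_of_le (by linarith)] at ha
    rw [abs_of_nonpos (by linarith [ha.2])]
    ring
  rw [this, integral_const_sub_id]
  ring

theorem integral_abs_sub_of_ge {ρ r : ℝ} (hr : 0 < r) (h : r ≤ ρ) :
    ∫ a in (-ρ)..ρ, |a - r| = ρ ^ 2 + r ^ 2 := by
  have hi : ∀ a b : ℝ, IntervalIntegrable (fun a => |a - r|) volume a b := fun a b =>
    Continuous.intervalIntegrable (by fun_prop) _ _
  rw [← intervalIntegral.integral_add_adjacent_intervals (hi (-ρ) r) (hi r ρ)]
  have h1 : ∫ a in (-ρ)..r, |a - r| = ∫ a in (-ρ)..r, (r - a) := by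
    refine intervalIntegral.integral_congr fun a ha => ?_
    rw [uIcc_of_le (by linarith)] at ha
    rw [abs_of_nonpos (by linarith [ha.2])]
    ring
  have h2 : ∫ a in r..ρ, |a - r| = ∫ a in r..ρ, -(r - a) := by
    refine intervalIntegral.integral_congr fun a ha => ?_
    rw [uIcc_of_le h] at ha
    rw [abs_of_nonneg (by linarith [ha.1])]
    ring
  rw [h1, h2, intervalIntegral.integral_neg, integral_const_sub_id, integral_const_sub_id]
  ring

theorem coulombPotential_ball_axis {ρ r : ℝ} (hρ : 0 < ρ) (hr : 0 < r) :
    coulombPotential (Metric.ball 0 ρ) !₂[r, 0, 0] = ENNReal.ofReal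
      ((((ρ + r) ^ 3 - |ρ - r| ^ 3) / (3 * r) - ∫ a in (-ρ)..ρ, |a - r|) / 2) := by
  set g : ℝ → ℝ → ℝ≥0∞ := fun a => (Iio (ρ ^ 2 - a ^ 2)).indicator
    fun u => ENNReal.ofReal (1 / (4 * π * √((a - r) ^ 2 + u))) with hg
  have hgm : ∀ a, Measurable (g a) := fun a =>
    Measurable.indicator (by fun_prop) measurableSet_Iio
  have hsection : ∀ a : ℝ, a ≠ r → ENNReal.ofReal (2 * π) *
      ∫⁻ t in Ioi (0 : ℝ), ENNReal.ofReal t * g a (t ^ 2) =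
      (Ioo (-ρ) ρ).indicator (fun a => ENNReal.ofReal
        ((√(ρ ^ 2 + r ^ 2 - 2 * a * r) - |a - r|) / 2)) a := by
    intro a ha
    by_cases hmem : a ∈ Ioo (-ρ) ρ
    · have hq : 0 < ρ ^ 2 - a ^ 2 := by nlinarith [hmem.1, hmem.2]
      rw [indicator_of_mem hmem]
      have h1 : ∀ t ∈ Ioi (0 : ℝ), ENNReal.ofReal t * g a (t ^ 2) =
          (Ioo 0 (√(ρ ^ 2 - a ^ 2))).indicator (fun t => ENNReal.ofReal (1 / (4 * π)) *
            ENNReal.ofReal (t / √((a - r) ^ 2 + t ^ 2))) t := by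
        intro t ht
        have ht : 0 < t := ht
        have hiff : t ^ 2 ∈ Iio (ρ ^ 2 - a ^ 2) ↔ t ∈ Ioo 0 (√(ρ ^ 2 - a ^ 2)) := by
          simp [lt_sqrt ht.le, ht]
        by_cases hin : t ^ 2 ∈ Iio (ρ ^ 2 - a ^ 2)
        · rw [indicator_of_mem (hiff.1 hin), hg]
          dsimp only
          rw [indicator_of_mem hin, ← ENNReal.ofReal_mul ht.le,
            ← ENNReal.ofReal_mul (by positivity)]
          congr 1
          ring
        · rw [indicator_of_notMem (fun h => hin (hiff.2 h)), hg]
          dsimp only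
          rw [indicator_of_notMem hin, mul_zero]
      rw [setLIntegral_congr_fun measurableSet_Ioi h1, setLIntegral_indicator measurableSet_Ioo,
        inter_eq_left.2 Ioo_subset_Ioi_self, lintegral_const_mul _ (by fun_prop),
        lintegral_inv_dist_disc (sub_ne_zero.2 ha) hq.le, ← ENNReal.ofReal_mul (by positivity),
        ← ENNReal.ofReal_mul (by positivity)]
      congr 1
      have : (a - r) ^ 2 + (ρ ^ 2 - a ^ 2) = ρ ^ 2 + r ^ 2 - 2 * a * r := by ring
      rw [this]
      field_simp
      norm_num
    · rw [indicator_of_notMem hmem]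
      have hq : ρ ^ 2 - a ^ 2 ≤ 0 := by
        by_contra! hlt
        exact hmem (abs_lt.1 (abs_lt_of_sq_lt_sq (by linarith) hρ.le))
      have h1 : ∀ t : ℝ, g a (t ^ 2) = 0 := fun t =>
        indicator_of_notMem (fun h => by
          have : t ^ 2 < ρ ^ 2 - a ^ 2 := h
          nlinarith [sq_nonneg t]) _
      simp [h1]
  have hstart : coulombPotential (Metric.ball 0 ρ) !₂[r, 0, 0] =
      ∫⁻ a : ℝ, ∫⁻ p : ℝ × ℝ, g a (p.1 ^ 2 + p.2 ^ 2) := by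
    unfold coulombPotential
    rw [← lintegral_indicator Metric.isOpen_ball.measurableSet, lintegral_E3_eq
      (Measurable.indicator (by fun_prop) Metric.isOpen_ball.measurableSet)]
    refine lintegral_congr fun a => lintegral_congr fun p => ?_
    have hiff : !₂[a, p.1, p.2] ∈ Metric.ball (0 : E3) ρ ↔
        p.1 ^ 2 + p.2 ^ 2 ∈ Iio (ρ ^ 2 - a ^ 2) := by
      rw [mem_ball_zero_iff, EuclideanSpace.norm_eq, sqrt_lt' hρ, Fin.sum_univ_three]
      simp only [norm_eq_abs, sq_abs, mem_Iio, lt_sub_iff_add_lt]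
      simp [add_comm, add_assoc]
    have hnorm : ‖!₂[r, 0, 0] - !₂[a, p.1, p.2]‖ =
        √((a - r) ^ 2 + (p.1 ^ 2 + p.2 ^ 2)) := by
      rw [EuclideanSpace.norm_eq, Fin.sum_univ_three]
      simp only [norm_eq_abs, sq_abs]
      congr 1
      simp
      ring
    by_cases hin : p.1 ^ 2 + p.2 ^ 2 ∈ Iio (ρ ^ 2 - a ^ 2)
    · rw [indicator_of_mem (hiff.2 hin), hg]
      dsimp only
      rw [indicator_of_mem hin, coul, hnorm]
    · rw [indicator_of_notMem (fun h => hin (hiff.1 h)), hg]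
      dsimp only
      rw [indicator_of_notMem hin]
  have hcont : Continuous fun a : ℝ => (√(ρ ^ 2 + r ^ 2 - 2 * a * r) - |a - r|) / 2 := by
    fun_prop
  have hae : ∀ᵐ a : ℝ, a ≠ r := by
    have : (volume : Measure ℝ) {r} = 0 := measure_singleton r
    exact compl_mem_ae_iff.2 this
  rw [hstart]
  simp_rw [lintegral_plane_radial (hgm _)]
  rw [lintegral_congr_ae (hae.mono hsection), lintegral_indicator measurableSet_Ioo,
    ← integral_sqrt_axial hρ hr, ← intervalIntegral.integral_sub
      (Continuous.intervalIntegrable (by fun_prop) _ _)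
      (Continuous.intervalIntegrable (by fun_prop) _ _), ← intervalIntegral.integral_div,
    intervalIntegral.integral_of_le (by linarith), integral_Ioc_eq_integral_Ioo,
    ofReal_integral_eq_lintegral_ofReal]
  · exact hcont.integrableOn_Icc.mono_set Ioo_subset_Icc_self
  · refine (ae_restrict_iff' measurableSet_Ioo).2 (Filter.Eventually.of_forall fun a ha => ?_)
    have : |a - r| ≤ √(ρ ^ 2 + r ^ 2 - 2 * a * r) := by
      refine abs_le_sqrt ?_
      nlinarith [ha.1, ha.2]
    simp only [Pi.zero_apply]
    linarith

theorem coulombPotential_ball_eq_axis (ρ : ℝ) (x : E3) :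
    coulombPotential (Metric.ball 0 ρ) x = coulombPotential (Metric.ball 0 ρ) !₂[‖x‖, 0, 0] := by
  have hnorm : ‖x‖ = ‖(!₂[‖x‖, 0, 0] : E3)‖ := by
    rw [EuclideanSpace.norm_eq !₂[‖x‖, 0, 0], Fin.sum_univ_three]
    simp
  set e := (ℝ ∙ (x - !₂[‖x‖, 0, 0]))ᗮ.reflection
  have he : e x = !₂[‖x‖, 0, 0] := Submodule.reflection_sub hnorm
  rw [← coulombPotential_image_linearIsometryEquiv e, he, LinearIsometryEquiv.image_ball, map_zero]

/-- Newton's theorem outside a ball of uniform charge. -/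
theorem coulombPotential_ball_of_le {ρ : ℝ} (hρ : 0 < ρ) {x : E3} (hx : ρ ≤ ‖x‖) :
    coulombPotential (Metric.ball 0 ρ) x = ENNReal.ofReal (ρ ^ 3 / (3 * ‖x‖)) := by
  have hr : 0 < ‖x‖ := hρ.trans_le hx
  rw [coulombPotential_ball_eq_axis, coulombPotential_ball_axis hρ hr,
    integral_abs_sub_of_le hρ hx, abs_of_nonpos (by linarith)]
  congr 1
  field_simp
  ring

/-- Newton's theorem inside a ball of uniform charge. -/
theorem coulombPotential_ball_of_ge {ρ : ℝ} {x : E3} (h0 : x ≠ 0) (hx : ‖x‖ ≤ ρ) :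
    coulombPotential (Metric.ball 0 ρ) x = ENNReal.ofReal (ρ ^ 2 / 2 - ‖x‖ ^ 2 / 6) := by
  have hr : 0 < ‖x‖ := norm_pos_iff.2 h0
  rw [coulombPotential_ball_eq_axis, coulombPotential_ball_axis (hr.trans_le hx) hr,
    integral_abs_sub_of_ge hr hx, abs_of_nonneg (by linarith)]
  congr 1
  field_simp
  ring

theorem coulombPotential_preimage_add (B : Set E3) (c x : E3) :
    coulombPotential ((· + c) ⁻¹' B) x = coulombPotential B (x + c) := by
  unfold coulombPotential
  rw [← (measurePreserving_add_right volume c).setLIntegral_comp_preimage_emb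
    (measurableEmbedding_addRight c) _ B]
  simp only [coul, add_sub_add_right_eq_sub]

theorem coulombPotential_mono {A B : Set E3} (h : A ⊆ B) (x : E3) :
    coulombPotential A x ≤ coulombPotential B x :=
  lintegral_mono_set h

theorem exists_coulombPotential_le :
    ∃ K : ℝ≥0∞, K ≠ ∞ ∧ ∀ (B : Set E3) (x : E3),
      coulombPotential B x ≤ K + ENNReal.ofReal (1 / (4 * π)) * volume B := by
  set e : E3 := EuclideanSpace.single 0 1 with he
  have hnorm : ‖e‖ = 1 := by simp [he]
  refine ⟨coulombPotential (Metric.ball 0 2) e, ?_, fun B x => ?_⟩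
  · rw [coulombPotential_ball_of_ge (norm_pos_iff.1 (by rw [hnorm]; norm_num))
      (by rw [hnorm]; norm_num)]
    exact ENNReal.ofReal_ne_top
  have hnear : coulombPotential (Metric.ball x 1) x ≤ coulombPotential (Metric.ball 0 2) e := by
    have hx : x = e + (x - e) := by abel
    conv_lhs => rw [hx]
    rw [← coulombPotential_preimage_add]
    refine coulombPotential_mono (fun y hy => ?_) _
    rw [mem_preimage, mem_ball_iff_norm] at hy
    rw [mem_ball_zero_iff]
    have : y = (y + (x - e) - (e + (x - e))) + e := by abel
    rw [this]
    refine (norm_add_le _ _).trans_lt ?_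
    linarith
  have hpt : ∀ y, ENNReal.ofReal (coul x y) ≤
      (Metric.ball x 1).indicator (fun y => ENNReal.ofReal (coul x y)) y +
        ENNReal.ofReal (1 / (4 * π)) := by
    intro y
    by_cases hy : y ∈ Metric.ball x 1
    · rw [indicator_of_mem hy]
      exact le_self_add
    · rw [indicator_of_notMem hy, zero_add]
      refine ENNReal.ofReal_le_ofReal ?_
      rw [Metric.mem_ball', dist_eq_norm, not_lt] at hy
      refine one_div_le_one_div_of_le (by positivity) ?_
      nlinarith [pi_pos]
  calc coulombPotential B x ≤ ∫⁻ y in B,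
        ((Metric.ball x 1).indicator (fun y => ENNReal.ofReal (coul x y)) y +
          ENNReal.ofReal (1 / (4 * π))) := lintegral_mono hpt
    _ = (∫⁻ y in B, (Metric.ball x 1).indicator (fun y => ENNReal.ofReal (coul x y)) y) +
          ENNReal.ofReal (1 / (4 * π)) * volume B := by
        rw [lintegral_add_right _ measurable_const, setLIntegral_const]
    _ ≤ _ := by
        gcongr
        refine (setLIntegral_le_lintegral _ _).trans ?_
        rw [lintegral_indicator Metric.isOpen_ball.measurableSet]
        exact hnear

theorem coulombPotential_ne_top {B : Set E3} (hB : volume B < ⊤) (x : E3) :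
    coulombPotential B x ≠ ∞ := by
  obtain ⟨K, hK, h⟩ := exists_coulombPotential_le
  exact ((h B x).trans_lt (ENNReal.add_lt_top.2
    ⟨hK.lt_top, ENNReal.mul_lt_top ENNReal.ofReal_lt_top hB⟩)).ne

theorem mutualEnergy_ne_top {A B : Set E3} (hA : volume A < ⊤) (hB : volume B < ⊤) :
    mutualEnergy A B ≠ ∞ := by
  obtain ⟨K, hK, h⟩ := exists_coulombPotential_le
  refine ((lintegral_mono (h B)).trans_lt ?_).ne
  rw [setLIntegral_const]
  exact ENNReal.mul_lt_top (ENNReal.add_lt_top.2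
    ⟨hK.lt_top, ENNReal.mul_lt_top ENNReal.ofReal_lt_top hB⟩) hA

theorem integral_integral_coul (A : Set E3) {B : Set E3} (hB : volume B < ⊤) :
    ∫ x in A, ∫ y in B, coul x y = (mutualEnergy A B).toReal := by
  have h : ∀ x, ∫ y in B, coul x y = (coulombPotential B x).toReal := fun x =>
    integral_eq_lintegral_of_nonneg_ae (Filter.Eventually.of_forall (coul_nonneg x))
      (measurable_coul.comp measurable_prodMk_left).aestronglyMeasurable
  simp_rw [h]
  exact integral_toReal (measurable_coulombPotential B).aemeasurable
    (Filter.Eventually.of_forall fun x => (coulombPotential_ne_top hB x).lt_top)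

theorem energy_eq_mutualEnergy {P A : Set E3} (hP : volume P < ⊤) (hA : volume A < ⊤) :
    energy P A = (mutualEnergy P P).toReal + (mutualEnergy A A).toReal -
      2 * (mutualEnergy A P).toReal := by
  rw [energy, integral_integral_coul _ hP, integral_integral_coul _ hA,
    integral_integral_coul _ hA, mutualEnergy_comm P A]

theorem mutualEnergy_inter_add_diff (A B : Set E3) {D : Set E3} (hD : MeasurableSet D) :
    mutualEnergy (A ∩ D) B + mutualEnergy (A \ D) B = mutualEnergy A B :=
  lintegral_inter_add_sdiff _ _ hD

theorem toReal_mutualEnergy_inter_add_diff {A B D : Set E3} (hA : volume A < ⊤)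
    (hB : volume B < ⊤) (hD : MeasurableSet D) :
    (mutualEnergy (A ∩ D) B).toReal + (mutualEnergy (A \ D) B).toReal =
      (mutualEnergy A B).toReal := by
  rw [← mutualEnergy_inter_add_diff A B hD, ENNReal.toReal_add]
  · exact mutualEnergy_ne_top ((measure_mono inter_subset_left).trans_lt hA) hB
  · exact mutualEnergy_ne_top ((measure_mono sdiff_subset).trans_lt hA) hB

theorem mutualEnergy_congr_left {A A' : Set E3} (h : A =ᵐ[volume] A') (B : Set E3) :
    mutualEnergy A B = mutualEnergy A' B :=
  setLIntegral_congr h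

/-- A set of zero Coulomb self-energy is null. -/
theorem volume_eq_zero_of_mutualEnergy_self {N : Set E3}
    (h : mutualEnergy N N = 0) : volume N = 0 := by
  by_contra hne
  have hae := (lintegral_eq_zero_iff (measurable_coulombPotential N)).1 h
  have : (ae (volume.restrict N)).NeBot := ae_restrict_neBot.2 hne
  obtain ⟨x, hx⟩ := hae.exists
  have hx' := (lintegral_eq_zero_iff (measurable_ofReal_coul.comp measurable_prodMk_left)).1 hx
  have hsingle : (volume : Measure E3) {x} = 0 := measure_singleton x
  have hx2 : ∀ᵐ y ∂(volume.restrict N), y ≠ x :=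
    ae_restrict_of_ae (compl_mem_ae_iff.2 hsingle)
  obtain ⟨y, hy, hyx⟩ := (hx'.and hx2).exists
  have hpos : 0 < coul x y := by
    have : 0 < ‖x - y‖ := norm_pos_iff.2 (sub_ne_zero.2 hyx.symm)
    unfold coul
    positivity
  exact (ENNReal.ofReal_pos.2 hpos).ne' hy

section Annulus

variable {R S : ℝ}

theorem coulombPotential_ball_eq_add (hRS : R ≤ S) (x : E3) :
    coulombPotential (Metric.ball 0 S) x = coulombPotential (Metric.ball 0 R) x +
      coulombPotential (Metric.ball 0 S \ Metric.closedBall 0 R) x := by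
  unfold coulombPotential
  have hsphere : volume (Metric.sphere (0 : E3) R) = 0 := Measure.addHaar_sphere _ _ _
  rw [← lintegral_inter_add_sdiff _ (Metric.ball (0 : E3) S)
    (Metric.isClosed_closedBall (x := (0 : E3)) (ε := R)).measurableSet]
  congr 1
  refine setLIntegral_congr ?_
  have h : Metric.closedBall (0 : E3) R =ᵐ[volume] Metric.ball 0 R := by
    rw [← Metric.ball_union_sphere]
    exact union_ae_eq_left_of_ae_eq_empty (ae_eq_empty.2 hsphere)
  have h' := (Filter.EventuallyEq.refl (ae volume) (Metric.ball (0 : E3) S)).inter h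
  rwa [inter_eq_right.2 (Metric.ball_subset_ball hRS)] at h'

theorem volume_annulus_lt_top :
    volume (Metric.ball (0 : E3) S \ Metric.closedBall 0 R) < ⊤ :=
  (measure_mono sdiff_subset).trans_lt measure_ball_lt_top

theorem toReal_coulombPotential_annulus (hRS : R ≤ S) (x : E3) :
    (coulombPotential (Metric.ball 0 S \ Metric.closedBall 0 R) x).toReal =
      (coulombPotential (Metric.ball 0 S) x).toReal -
        (coulombPotential (Metric.ball 0 R) x).toReal := by
  rw [coulombPotential_ball_eq_add hRS, ENNReal.toReal_add
    (coulombPotential_ne_top measure_ball_lt_top x)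
    (coulombPotential_ne_top volume_annulus_lt_top x)]
  ring

/-- The screening annulus of equal volume neutralises the ball outside. -/
theorem coulombPotential_annulus_eq (hR : 0 < R) (hRS : R ≤ S) (hS : S ^ 3 = 2 * R ^ 3) {x : E3}
    (hx : S ≤ ‖x‖) :
    coulombPotential (Metric.ball 0 S \ Metric.closedBall 0 R) x =
      coulombPotential (Metric.ball 0 R) x := by
  have hS0 : 0 < S := hR.trans_le hRS
  rw [← ENNReal.toReal_eq_toReal_iff' (coulombPotential_ne_top volume_annulus_lt_top x)
      (coulombPotential_ne_top measure_ball_lt_top x), toReal_coulombPotential_annulus hRS,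
    coulombPotential_ball_of_le hS0 hx, coulombPotential_ball_of_le hR
      (hRS.trans hx), ENNReal.toReal_ofReal (by positivity), ENNReal.toReal_ofReal (by positivity),
    hS]
  ring

theorem coulombPotential_annulus_lt (hR : 0 < R) (hS : S ^ 3 = 2 * R ^ 3) {x : E3}
    (hRx : R ≤ ‖x‖) (hx : ‖x‖ < S) :
    coulombPotential (Metric.ball 0 S \ Metric.closedBall 0 R) x <
      coulombPotential (Metric.ball 0 R) x := by
  have hr : 0 < ‖x‖ := hR.trans_le hRx
  rw [← ENNReal.toReal_lt_toReal (coulombPotential_ne_top volume_annulus_lt_top x)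
      (coulombPotential_ne_top measure_ball_lt_top x),
    toReal_coulombPotential_annulus (hRx.trans hx.le),
    coulombPotential_ball_of_ge (norm_pos_iff.1 hr) hx.le, coulombPotential_ball_of_le hR hRx,
    ENNReal.toReal_ofReal (by nlinarith), ENNReal.toReal_ofReal (by positivity), ← sub_pos]
  have : R ^ 3 / (3 * ‖x‖) - (S ^ 2 / 2 - ‖x‖ ^ 2 / 6 - R ^ 3 / (3 * ‖x‖)) =
      (S - ‖x‖) ^ 2 * (2 * S + ‖x‖) / (6 * ‖x‖) := by
    have hR3 : R ^ 3 = S ^ 3 / 2 := by linarith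
    rw [hR3]
    field_simp
    ring
  rw [this]
  have h1 : 0 < S - ‖x‖ := sub_pos.2 hx
  have h2 : 0 < S := hr.trans hx
  positivity

/-- Outside the annulus the annulus and the ball generate the same potential. -/
theorem mutualEnergy_diff_annulus (hR : 0 < R) (hRS : R ≤ S) (hS : S ^ 3 = 2 * R ^ 3) {A : Set E3}
    (hAm : MeasurableSet A) (hA : volume (Metric.ball 0 R ∩ A) = 0) :
    mutualEnergy (A \ (Metric.ball 0 S \ Metric.closedBall 0 R))
        (Metric.ball 0 S \ Metric.closedBall 0 R) =
      mutualEnergy (A \ (Metric.ball 0 S \ Metric.closedBall 0 R)) (Metric.ball 0 R) := by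
  have hsphere : volume (Metric.sphere (0 : E3) R) = 0 := Measure.addHaar_sphere _ _ _
  refine setLIntegral_congr_fun_ae (hAm.diff (Metric.isOpen_ball.measurableSet.diff
    Metric.isClosed_closedBall.measurableSet)) ?_
  filter_upwards [compl_mem_ae_iff.2 hA, compl_mem_ae_iff.2 hsphere] with x h1 h2 hx
  refine coulombPotential_annulus_eq hR hRS hS ?_
  by_contra! hlt
  simp only [mem_compl_iff, mem_inter_iff, mem_ball_zero_iff, mem_sphere_zero_iff_norm, mem_sdiff,
    mem_closedBall_zero_iff] at h1 h2 hx
  rcases lt_trichotomy ‖x‖ R with h | h | h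
  · exact h1 ⟨h, hx.1⟩
  · exact h2 h
  · exact hx.2 ⟨hlt, not_le.2 h⟩

/-- The energy excess over the annulus, as a sum of two nonnegative terms. -/
theorem energy_sub_energy_annulus (hR : 0 < R) (hRS : R ≤ S) (hS : S ^ 3 = 2 * R ^ 3) {A C : Set E3}
    (hC : C = Metric.ball 0 S \ Metric.closedBall 0 R) (hA : Adm (Metric.ball 0 R) A) :
    energy (Metric.ball 0 R) A - energy (Metric.ball 0 R) C =
      ((mutualEnergy A A).toReal + (mutualEnergy C C).toReal - 2 * (mutualEnergy A C).toReal) +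
      2 * ((mutualEnergy (C \ A) (Metric.ball 0 R)).toReal - (mutualEnergy (C \ A) C).toReal) := by
  have hP : volume (Metric.ball (0 : E3) R) < ⊤ := measure_ball_lt_top
  have hCv : volume C < ⊤ := hC ▸ volume_annulus_lt_top
  have hCm : MeasurableSet C := hC ▸ Metric.isOpen_ball.measurableSet.diff
    Metric.isClosed_closedBall.measurableSet
  rw [energy_eq_mutualEnergy hP hA.2.2, energy_eq_mutualEnergy hP hCv]
  have h0 : mutualEnergy (A \ C) C = mutualEnergy (A \ C) (Metric.ball 0 R) := by
    rw [hC]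
    exact mutualEnergy_diff_annulus hR hRS hS hA.1 hA.2.1
  have h1 := toReal_mutualEnergy_inter_add_diff hA.2.2 hP hCm
  have h2 := toReal_mutualEnergy_inter_add_diff hA.2.2 hCv hCm
  have h3 := toReal_mutualEnergy_inter_add_diff hCv hP hA.1
  have h4 := toReal_mutualEnergy_inter_add_diff hCv hCv hA.1
  rw [inter_comm C A] at h3 h4
  rw [h0] at h2
  linarith

end Annulus

theorem two_mul_toReal_mutualEnergy_le {A B : Set E3} (hA : volume A < ⊤) (hB : volume B < ⊤) :
    2 * (mutualEnergy A B).toReal ≤ (mutualEnergy A A).toReal + (mutualEnergy B B).toReal := by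
  have h := ENNReal.toReal_mono (ENNReal.add_ne_top.2
    ⟨mutualEnergy_ne_top hA hA, mutualEnergy_ne_top hB hB⟩) (two_mul_mutualEnergy_le A B)
  rwa [ENNReal.toReal_mul, ENNReal.toReal_add (mutualEnergy_ne_top hA hA)
    (mutualEnergy_ne_top hB hB), ENNReal.toReal_ofNat] at h

/-- If `C ⊆ A` up to a null set and the polarised self-energy of `A` and `C` vanishes, then
`A \ C` is null. -/
theorem volume_diff_eq_zero_of_mutualEnergy {A C : Set E3}
    (hCm : MeasurableSet C) (hA : volume A < ⊤) (hC : volume C < ⊤) (hCA : volume (C \ A) = 0)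
    (h : (mutualEnergy A A).toReal + (mutualEnergy C C).toReal =
      2 * (mutualEnergy A C).toReal) :
    volume (A \ C) = 0 := by
  have hN : volume (A \ C) < ⊤ := (measure_mono sdiff_subset).trans_lt hA
  have hinter : (A ∩ C : Set E3) =ᵐ[volume] C := by
    rw [inter_comm, ← sdiff_sdiff_right_self]
    exact sdiff_null_ae_eq_self hCA
  have hsplit : ∀ B : Set E3, volume B < ⊤ →
      (mutualEnergy C B).toReal + (mutualEnergy (A \ C) B).toReal = (mutualEnergy A B).toReal := by
    intro B hB
    rw [← toReal_mutualEnergy_inter_add_diff hA hB hCm, mutualEnergy_congr_left hinter]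
  have h1 := hsplit A hA
  have h2 := hsplit C hC
  have h3 := hsplit (A \ C) hN
  rw [mutualEnergy_comm C A] at h1
  rw [mutualEnergy_comm A, mutualEnergy_comm C] at h3
  have h0 : (mutualEnergy (A \ C) (A \ C)).toReal = 0 := by linarith
  refine volume_eq_zero_of_mutualEnergy_self ?_
  exact ((ENNReal.toReal_eq_zero_iff _).1 h0).resolve_right (mutualEnergy_ne_top hN hN)

/-- **Corollary A.2** (The case of a ball): for `Ω⁺ = B_R(0)` the minimizer of
the unconstrained problem is, up to a Lebesgue null set, the annulus
`B_{2^{1/3}R}(0) \ closure (B_R(0))`. -/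
theorem ball_minimizer_is_annulus (R : ℝ) (hR : 0 < R) :
    let Ωp : Set E3 := Metric.ball 0 R
    let C : Set E3 := Metric.ball 0 ((2:ℝ) ^ ((1:ℝ)/3) * R) \ closure (Metric.ball 0 R)
    Adm Ωp C ∧
    (∀ A, Adm Ωp A → energy Ωp C ≤ energy Ωp A) ∧
    (∀ A, Adm Ωp A → (∀ B, Adm Ωp B → energy Ωp A ≤ energy Ωp B) →
      volume (symmDiff A C) = 0) := by
  intro Ωp C
  set S : ℝ := (2:ℝ) ^ ((1:ℝ)/3) * R with hSdef
  have hS : S ^ 3 = 2 * R ^ 3 := by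
    rw [hSdef, mul_pow, ← rpow_natCast, ← rpow_mul (by norm_num)]
    norm_num
  have hRS : R ≤ S := by
    rw [hSdef]
    exact le_mul_of_one_le_left hR.le (one_le_rpow (by norm_num) (by norm_num))
  have hC : C = Metric.ball 0 S \ Metric.closedBall 0 R := by
    change Metric.ball 0 S \ closure (Metric.ball 0 R) = _
    rw [closure_ball _ hR.ne']
  have hCm : MeasurableSet C := hC ▸ Metric.isOpen_ball.measurableSet.diff
    Metric.isClosed_closedBall.measurableSet
  have hCv : volume C < ⊤ := hC ▸ volume_annulus_lt_top
  have hadm : Adm Ωp C := by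
    refine ⟨hCm, ?_, hCv⟩
    have : Ωp ∩ C = ∅ := by
      rw [hC]
      ext x
      simp only [mem_inter_iff, mem_sdiff, mem_empty_iff_false, iff_false]
      exact fun h => h.2.2 (Metric.ball_subset_closedBall h.1)
    rw [this, measure_empty]
  have hlt : ∀ x ∈ C, coulombPotential C x < coulombPotential Ωp x := by
    intro x hx
    rw [hC] at hx ⊢
    rw [mem_sdiff, mem_ball_zero_iff, mem_closedBall_zero_iff, not_le] at hx
    exact coulombPotential_annulus_lt hR hS hx.2.le hx.1
  have hP : volume Ωp < ⊤ := measure_ball_lt_top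
  have hdiff : ∀ A : Set E3, volume (C \ A) < ⊤ := fun A =>
    (measure_mono sdiff_subset).trans_lt hCv
  have hgap : ∀ A, Adm Ωp A →
      (mutualEnergy (C \ A) C).toReal ≤ (mutualEnergy (C \ A) Ωp).toReal := by
    intro A hA
    refine ENNReal.toReal_mono (mutualEnergy_ne_top (hdiff A) hP) ?_
    exact setLIntegral_mono (measurable_coulombPotential _) fun x hx => (hlt x hx.1).le
  refine ⟨hadm, fun A hA => ?_, fun A hA hmin => ?_⟩
  · have h1 := energy_sub_energy_annulus hR hRS hS hC hA
    have h2 := two_mul_toReal_mutualEnergy_le hA.2.2 hCv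
    have h3 := hgap A hA
    linarith
  · have h1 := energy_sub_energy_annulus hR hRS hS hC hA
    have h2 := two_mul_toReal_mutualEnergy_le hA.2.2 hCv
    have h3 := hgap A hA
    have h4 := hmin C hadm
    have hCA : volume (C \ A) = 0 := by
      by_contra hne
      have hstrict : mutualEnergy (C \ A) C < mutualEnergy (C \ A) Ωp :=
        setLIntegral_strict_mono (hCm.diff hA.1) hne (measurable_coulombPotential _)
          (mutualEnergy_ne_top (hdiff A) hCv)
          (Filter.Eventually.of_forall fun x hx => hlt x hx.1)
      have := (ENNReal.toReal_lt_toReal (mutualEnergy_ne_top (hdiff A) hCv)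
        (mutualEnergy_ne_top (hdiff A) hP)).2 hstrict
      linarith
    have hAC : volume (A \ C) = 0 :=
      volume_diff_eq_zero_of_mutualEnergy hCm hA.2.2 hCv hCA (by linarith)
    exact measure_union_null hAC hCA
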